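/- Let n be odd, let 1 ≤ k ≤ n/2, and let G be a family of intervals in Z/nZ that is intersecting and k-Sperner with Σ_{G ∈ G} C(n, |G|) = n · Σ_I(n,k). Then G consists of all intervals in Z/nZ whose size lies between ⌊n/2⌋+1 and ⌊n/2⌋+k. -/

import Mathlib

/-- `Σ_I(n,k)` from the paper. -/
def SigmaI (n k : ℕ) : ℕ :=
  if n % 2 = 1 then
    ∑ i ∈ Finset.Icc ((n + 1) / 2) ((n + 1) / 2 + k - 1), Nat.choose n i
  else
    Nat.choose (n - 1) (n / 2 - 1) +
      ∑ i ∈ Finset.Icc (n / 2 + 1) (n / 2 + k - 1), Nat.choose n i +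
      Nat.choose (n - 1) (n / 2 + k)

/-- A family of finite sets is intersecting if any two members meet. -/
def Intersecting {α : Type*} [DecidableEq α] (F : Finset (Finset α)) : Prop :=
  ∀ A ∈ F, ∀ B ∈ F, (A ∩ B).Nonempty

/-- A family is butterfly-free if there are no four distinct members
`A,B,C,D` with `A ⊆ C`, `A ⊆ D`, `B ⊆ C`, `B ⊆ D`. -/
def ButterflyFree {α : Type*} (F : Finset (Finset α)) : Prop :=
  ¬ ∃ A B C D : Finset α, A ∈ F ∧ B ∈ F ∧ C ∈ F ∧ D ∈ F ∧
    A ≠ B ∧ A ≠ C ∧ A ≠ D ∧ B ≠ C ∧ B ≠ D ∧ C ≠ D ∧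
    A ⊆ C ∧ A ⊆ D ∧ B ⊆ C ∧ B ⊆ D

/-- A family is `k`-Sperner if it contains no chain of `k+1` distinct sets. -/
def KSperner {α : Type*} (k : ℕ) (F : Finset (Finset α)) : Prop :=
  ¬ ∃ c : Fin (k + 1) → Finset α, (∀ i, c i ∈ F) ∧ StrictMono c

/-- `S ⊆ ZMod n` is an interval if it is `{i, i+1, …, i+j-1}` for some
`i : ZMod n` and `1 ≤ j ≤ n`. -/
def IsInterval (n : ℕ) (S : Finset (ZMod n)) : Prop :=
  ∃ (i : ZMod n) (j : ℕ), 1 ≤ j ∧ j ≤ n ∧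
    S = (Finset.range j).image (fun t : ℕ => i + (t : ZMod n))

/-- The interval `A_i^j = {i, i+1, …, i+j-1}` in `ZMod n`. -/
def IntervalA (n : ℕ) (i : ZMod n) (j : ℕ) : Finset (ZMod n) :=
  (Finset.range j).image (fun t : ℕ => i + (t : ZMod n))


open Finset

section Intervals

variable {n : ℕ}

lemma card_intervalA (i : ZMod n) {j : ℕ} (hj : j ≤ n) : (IntervalA n i j).card = j := by
  rw [IntervalA, card_image_of_injOn, card_range]
  intro a ha b hb hab
  rw [coe_range, Set.mem_Iio] at ha hb
  have h := (ZMod.natCast_eq_natCast_iff' a b n).1 (add_left_cancel hab)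
  rwa [Nat.mod_eq_of_lt (by omega), Nat.mod_eq_of_lt (by omega)] at h

lemma intervalA_ssubset_intervalA (i : ZMod n) {j l : ℕ} (hjl : j < l) (hl : l ≤ n) :
    IntervalA n i j ⊂ IntervalA n i l := by
  refine Finset.ssubset_iff_subset_ne.2 ⟨image_subset_image (range_subset_range.2 hjl.le), fun h => ?_⟩
  have := congrArg card h
  rw [card_intervalA i (by omega), card_intervalA i hl] at this
  omega

lemma disjoint_intervalA (i : ZMod n) {j l : ℕ} (h : j + l ≤ n) :
    IntervalA n i j ∩ IntervalA n (i + j) l = ∅ := by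
  refine eq_empty_of_forall_notMem fun x hx => ?_
  simp only [IntervalA, mem_inter, mem_image, mem_range] at hx
  obtain ⟨⟨a, ha, rfl⟩, b, hb, hab⟩ := hx
  rw [add_assoc, ← Nat.cast_add] at hab
  have h := (ZMod.natCast_eq_natCast_iff' (j + b) a n).1 (add_left_cancel hab)
  rw [Nat.mod_eq_of_lt (by omega), Nat.mod_eq_of_lt (by omega)] at h
  omega

lemma isInterval_iff {S : Finset (ZMod n)} :
    IsInterval n S ↔ ∃ (i : ZMod n) (j : ℕ), 1 ≤ j ∧ j ≤ n ∧ S = IntervalA n i j :=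
  Iff.rfl

lemma Intersecting.not_disjoint_intervalA {G : Finset (Finset (ZMod n))} (hG : Intersecting G)
    {i : ZMod n} {j l : ℕ} (h : j + l ≤ n) (hj : IntervalA n i j ∈ G) :
    IntervalA n (i + j) l ∉ G := fun hl => by
  simpa [disjoint_intervalA i h] using hG _ hj _ hl

lemma KSperner.card_filter_intervalA_le {G : Finset (Finset (ZMod n))} {k : ℕ}
    (hG : KSperner k G) (i : ZMod n) :
    #{j ∈ range (n + 1) | IntervalA n i j ∈ G} ≤ k := by
  by_contra! hcard
  set J := {j ∈ range (n + 1) | IntervalA n i j ∈ G} with hJ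
  let e := J.orderEmbOfCardLe hcard
  have he (t) : e t ∈ J := J.orderEmbOfCardLe_mem hcard t
  refine hG ⟨fun t => IntervalA n i (e t), fun t => (mem_filter.1 (he t)).2, fun s t hst => ?_⟩
  have := mem_range.1 (mem_filter.1 (he t)).1
  exact intervalA_ssubset_intervalA i (e.strictMono hst) (by omega)

lemma sum_le_sum_intervalA [NeZero n] {G : Finset (Finset (ZMod n))}
    (hint : ∀ S ∈ G, IsInterval n S) (w : ℕ → ℕ) :
    ∑ S ∈ G, w S.card ≤
      ∑ i : ZMod n, ∑ j ∈ range (n + 1), if IntervalA n i j ∈ G then w j else 0 := by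
  rw [← sum_product', ← sum_filter]
  set P := {p ∈ (univ : Finset (ZMod n)) ×ˢ range (n + 1) | IntervalA n p.1 p.2 ∈ G} with hP
  have hG : G ⊆ P.image fun p => IntervalA n p.1 p.2 := fun S hS => by
    obtain ⟨i, j, -, hj, rfl⟩ := isInterval_iff.1 (hint S hS)
    exact mem_image.2 ⟨(i, j), by simp [hP, hS]; omega, rfl⟩
  calc ∑ S ∈ G, w S.card
      ≤ ∑ S ∈ P.image fun p => IntervalA n p.1 p.2, w S.card :=
        sum_le_sum_of_subset hG
    _ ≤ ∑ p ∈ P, w (IntervalA n p.1 p.2).card := sum_image_le_of_nonneg (by simp)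
    _ = ∑ p ∈ P, w p.2 := sum_congr rfl fun p hp => by
        have := mem_range.1 (mem_product.1 (mem_filter.1 hp).1).2
        rw [card_intervalA _ (by omega)]

end Intervals

/-- Summing over all pairs (start, length) is the same as summing over complementary pairs of
arcs, the shorter one having length `m - s` and the longer one `m + 1 + s`. -/
lemma sum_eq_sum_complementary_pairs {A : Type*} [AddCommGroup A] [Fintype A]
    (a : ℕ → A) (m : ℕ) (F : A → ℕ → ℤ) :
    ∑ i, ∑ j ∈ range (2 * m + 2), F i j =
      ∑ i, ∑ s ∈ range (m + 1), (F i (m - s) + F (i + a (m - s)) (m + 1 + s)) := by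
  have hshift (s : ℕ) :
      ∑ i, F (i + a (m - s)) (m + 1 + s) = ∑ i, F i (m + 1 + s) :=
    Fintype.sum_equiv (Equiv.addRight (a (m - s))) _ _ fun _ => rfl
  simp_rw [sum_add_distrib]
  rw [sum_comm (f := fun i s => F (i + a (m - s)) (m + 1 + s))]
  simp_rw [hshift]
  rw [sum_comm (f := fun s i => F i (m + 1 + s)), ← sum_add_distrib]
  refine sum_congr rfl fun i _ => ?_
  rw [show 2 * m + 2 = (m + 1) + (m + 1) by ring, sum_range_add, add_left_inj]
  rw [← sum_range_reflect]
  exact sum_congr rfl fun s _ => by congr 1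

/-- Binomial coefficients strictly decrease above the middle. -/
lemma choose_lt_choose_of_middle_lt {m s t : ℕ} (hst : s < t) (ht : t ≤ m) :
    (2 * m + 1).choose (m + 1 + t) < (2 * m + 1).choose (m + 1 + s) := by
  induction t, hst using Nat.le_induction with
  | base =>
    have h := Nat.choose_succ_right_eq (2 * m + 1) (m + 1 + s)
    have hpos : 0 < (2 * m + 1).choose (m + 1 + s) := Nat.choose_pos (by omega)
    rw [show 2 * m + 1 - (m + 1 + s) = m - s by omega] at h
    by_contra! hle
    rw [Nat.succ_eq_add_one, ← add_assoc] at hle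
    nlinarith [Nat.sub_le m s]
  | succ t hst ih =>
    have h := Nat.choose_succ_right_eq (2 * m + 1) (m + 1 + t)
    have hpos : 0 < (2 * m + 1).choose (m + 1 + t) := Nat.choose_pos (by omega)
    rw [show 2 * m + 1 - (m + 1 + t) = m - t by omega] at h
    refine lt_trans ?_ (ih (by omega))
    by_contra! hle
    rw [← add_assoc] at hle
    nlinarith [Nat.sub_le m t]

theorem intersecting_kSperner_intervals_weight_eq (n k : ℕ) (hodd : n % 2 = 1)
    (hk1 : 1 ≤ k) (hk2 : 2 * k ≤ n)
    (G : Finset (Finset (ZMod n)))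
    (hint : ∀ S ∈ G, IsInterval n S)
    (hmeet : Intersecting G)
    (hS : KSperner k G)
    (hweight : ∑ S ∈ G, Nat.choose n S.card = n * SigmaI n k) :
    ∀ S : Finset (ZMod n),
      S ∈ G ↔ (IsInterval n S ∧ n / 2 + 1 ≤ S.card ∧ S.card ≤ n / 2 + k) := by
  classical
  obtain ⟨m, rfl⟩ : ∃ m, n = 2 * m + 1 := ⟨n / 2, by omega⟩
  have hk : k ≤ m := by omega
  have hhalf : (2 * m + 1) / 2 = m := by omega
  have hSigma : SigmaI (2 * m + 1) k = ∑ s ∈ range k, (2 * m + 1).choose (m + 1 + s) := by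
    rw [SigmaI, if_pos hodd, show (2 * m + 1 + 1) / 2 = m + 1 by omega,
      show Icc (m + 1) (m + 1 + k - 1) = Ico (m + 1) (m + 1 + k) by ext; simp; omega,
      sum_Ico_eq_sum_range]
    simp
  set f : ℕ → ℤ := fun s => ((2 * m + 1).choose (m + 1 + s) : ℤ) with hf
  have hanti {s t : ℕ} (hst : s < t) (ht : t ≤ m) : f t < f s := by
    exact Nat.cast_lt.2 (choose_lt_choose_of_middle_lt hst ht)
  -- The price of a set lies strictly between the weights on levels `k` and `k - 1`.
  set c : ℤ := f (k - 1) + f k with hc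
  have hcpos : 0 < c := by
    have : 0 ≤ f k := by simp [hf]
    linarith [hanti (show k - 1 < k by omega) hk]
  have hlow {s : ℕ} (hs : s < k) : 0 < 2 * f s - c := by
    have h1 := hanti (show k - 1 < k by omega) hk
    have h2 : f (k - 1) ≤ f s := by
      rcases (show s ≤ k - 1 by omega).eq_or_lt with rfl | h
      · rfl
      · exact (hanti h (by omega)).le
    linarith
  have hhigh {s : ℕ} (hs : k ≤ s) (hsm : s ≤ m) : 2 * f s - c < 0 := by
    have h1 := hanti (show k - 1 < k by omega) hk
    have h2 : f s ≤ f k := by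
      rcases hs.eq_or_lt with rfl | h
      · rfl
      · exact (hanti h hsm).le
    linarith
  let g (i : ZMod (2 * m + 1)) (j : ℕ) : ℤ := if IntervalA (2 * m + 1) i j ∈ G then 1 else 0
  let h (i : ZMod (2 * m + 1)) (s : ℕ) : ℤ := g i (m - s) + g (i + (m - s : ℕ)) (m + 1 + s)
  have hg0 (i j) : 0 ≤ g i j := by dsimp only [g]; split_ifs <;> simp
  have hh0 (i s) : 0 ≤ h i s := add_nonneg (hg0 _ _) (hg0 _ _)
  have hh1 (i) {s : ℕ} (hs : s ≤ m) : h i s ≤ 1 := by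
    have := hmeet.not_disjoint_intervalA (i := i) (j := m - s) (l := m + 1 + s) (by omega)
    dsimp only [h, g]
    split_ifs <;> simp_all
  have hpairs : ∑ i, ∑ j ∈ range (2 * m + 2), g i j * (2 * ((2 * m + 1).choose j : ℤ) - c) =
      ∑ i, ∑ s ∈ range (m + 1), h i s * (2 * f s - c) := by
    rw [sum_eq_sum_complementary_pairs (fun j => (j : ZMod (2 * m + 1)))]
    refine sum_congr rfl fun i _ => sum_congr rfl fun s hs => ?_
    have hs := mem_range.1 hs
    have hsymm : (2 * m + 1).choose (m - s) = (2 * m + 1).choose (m + 1 + s) :=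
      Nat.choose_symm_of_eq_add (by omega)
    rw [hsymm]
    ring
  have hterm (i) (s) (hs : s ∈ range (m + 1)) :
      h i s * (2 * f s - c) ≤ if s < k then 2 * f s - c else 0 := by
    have hs := mem_range.1 hs
    split_ifs with hsk
    · nlinarith [hlow hsk, hh1 i (show s ≤ m by omega)]
    · nlinarith [hhigh (not_lt.1 hsk) (by omega), hh0 i s]
  have hcard (i) : ∑ j ∈ range (2 * m + 2), g i j ≤ k := by
    have := hS.card_filter_intervalA_le i
    simp only [g, sum_boole]
    exact_mod_cast this
  have htop : ∑ s ∈ range (m + 1), (if s < k then 2 * f s - c else 0) =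
      2 * SigmaI (2 * m + 1) k - c * k := by
    rw [← sum_filter, show {s ∈ range (m + 1) | s < k} = range k by ext; simp; omega,
      sum_sub_distrib, ← mul_sum, hSigma]
    simp [hf, mul_comm]
  have hW : ((2 * m + 1) * SigmaI (2 * m + 1) k : ℤ) ≤
      ∑ i, ∑ j ∈ range (2 * m + 2), g i j * ((2 * m + 1).choose j : ℤ) := by
    have := sum_le_sum_intervalA hint (fun j => (2 * m + 1).choose j)
    rw [hweight] at this
    simp only [g, ite_mul, one_mul, zero_mul]
    exact_mod_cast this
  have hsplit : ∑ i, ∑ j ∈ range (2 * m + 2), g i j * (2 * ((2 * m + 1).choose j : ℤ) - c) =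
      2 * ∑ i, ∑ j ∈ range (2 * m + 2), g i j * ((2 * m + 1).choose j : ℤ) -
        c * ∑ i, ∑ j ∈ range (2 * m + 2), g i j := by
    simp only [mul_sum, ← sum_sub_distrib]
    exact sum_congr rfl fun i _ => sum_congr rfl fun j _ => by ring
  have hN : ∑ i, ∑ j ∈ range (2 * m + 2), g i j ≤ ∑ _i : ZMod (2 * m + 1), (k : ℤ) :=
    sum_le_sum fun i _ => hcard i
  have hH : ∑ i, ∑ s ∈ range (m + 1), h i s * (2 * f s - c) ≤
      ∑ _i : ZMod (2 * m + 1), ∑ s ∈ range (m + 1), if s < k then 2 * f s - c else 0 :=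
    sum_le_sum fun i _ => sum_le_sum (hterm i)
  have hconst (x : ℤ) : ∑ _i : ZMod (2 * m + 1), x = (2 * m + 1) * x := by
    simp [ZMod.card]
  have hNeq : ∑ i, ∑ j ∈ range (2 * m + 2), g i j = ∑ _i : ZMod (2 * m + 1), (k : ℤ) := by
    refine hN.antisymm ?_
    rw [← hpairs, hsplit, htop, hconst] at hH
    rw [hconst]
    nlinarith
  have hHeq : ∑ i, ∑ s ∈ range (m + 1), h i s * (2 * f s - c) =
      ∑ _i : ZMod (2 * m + 1), ∑ s ∈ range (m + 1), if s < k then 2 * f s - c else 0 := by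
    refine hH.antisymm ?_
    rw [← hpairs, hsplit, htop, hNeq, hconst, hconst]
    linarith
  have hchain (i) : ∑ j ∈ range (2 * m + 2), g i j = k :=
    (sum_eq_sum_iff_of_le fun i _ => hcard i).1 hNeq i (mem_univ i)
  have hlevel (i) {s : ℕ} (hs : s ≤ m) :
      h i s * (2 * f s - c) = if s < k then 2 * f s - c else 0 :=
    (sum_eq_sum_iff_of_le (hterm i)).1
      ((sum_eq_sum_iff_of_le fun i _ => sum_le_sum (hterm i)).1 hHeq i (mem_univ i)) s
      (mem_range.2 (by omega))
  have hsize (i) {j : ℕ} (hj : j ≤ 2 * m + 1) (hmem : IntervalA (2 * m + 1) i j ∈ G) :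
      j ≤ m + k := by
    by_contra! hlt
    obtain ⟨s, rfl⟩ : ∃ s, j = m + 1 + s := ⟨j - (m + 1), by omega⟩
    have h1 := hlevel (i - (m - s : ℕ)) (show s ≤ m by omega)
    rw [if_neg (by omega)] at h1
    have h2 := (mul_eq_zero.1 h1).resolve_right (hhigh (by omega) (by omega)).ne
    have h3 := hg0 (i - (m - s : ℕ)) (m - s)
    simp [h, g, hmem] at h2 h3
    linarith
  have hshort (i) {j : ℕ} (hj : j ≤ m) : IntervalA (2 * m + 1) i j ∉ G := fun hmem => by
    have hsub : {l ∈ range (2 * m + 2) | IntervalA (2 * m + 1) (i + j) l ∈ G} ⊆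
        Icc (m + 2) (m + k) := fun l hl => by
      obtain ⟨hl, hlG⟩ := mem_filter.1 hl
      have := mem_range.1 hl
      have : ¬ j + l ≤ 2 * m + 1 := fun hle => hmeet.not_disjoint_intervalA hle hmem hlG
      exact mem_Icc.2 ⟨by omega, hsize _ (by omega) hlG⟩
    have h1 := card_le_card hsub
    have h2 := hchain (i + j)
    simp only [g, sum_boole, Nat.cast_inj] at h2
    rw [h2, Nat.card_Icc] at h1
    omega
  have hmiddle (i) {s : ℕ} (hs : s < k) : IntervalA (2 * m + 1) i (m + 1 + s) ∈ G := by
    have h1 := hlevel (i - (m - s : ℕ)) (show s ≤ m by omega)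
    rw [if_pos hs] at h1
    have h2 := mul_right_cancel₀ (hlow hs).ne' (h1.trans (one_mul _).symm)
    by_contra hnot
    simp [h, g, hshort _ (Nat.sub_le m s), hnot] at h2
  intro S
  rw [hhalf]
  constructor
  · intro hSG
    refine ⟨hint S hSG, ?_⟩
    obtain ⟨i, j, -, hj, rfl⟩ := isInterval_iff.1 (hint S hSG)
    rw [card_intervalA i hj]
    exact ⟨by by_contra! hlt; exact hshort i (by omega) hSG, hsize i hj hSG⟩
  · rintro ⟨hI, hle, hge⟩
    obtain ⟨i, j, -, hj, rfl⟩ := isInterval_iff.1 hI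
    rw [card_intervalA i hj] at hle hge
    obtain ⟨s, rfl⟩ : ∃ s, j = m + 1 + s := ⟨j - (m + 1), by omega⟩
    exact hmiddle i (by omega)
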